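/- arXiv:2008.06077 — 3 statements merged into one kernel-verified Lean document; each statement's English description precedes it below -/
import Mathlib

section
/- The newform Dedekind sum vanishes at (1, q₁q₂): S_{χ₁,χ₂}(1, q₁q₂) = 0. -/
open scoped MatrixGroups
open CongruenceSubgroup Matrix

/-- The first Bernoulli function `B₁(x)`: equal to `x - ⌊x⌋ - 1/2` for non-integral `x`
and `0` for integral `x`. -/
noncomputable def B1 (x : ℝ) : ℝ := if Int.fract x = 0 then 0 else Int.fract x - 1/2

/-- The newform Dedekind sum `S_{χ₁,χ₂}(a, c)`. -/
noncomputable def ded {q₁ q₂ : ℕ} (χ₁ : DirichletCharacter ℂ q₁)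
    (χ₂ : DirichletCharacter ℂ q₂) (a c : ℤ) : ℂ :=
  ∑ j ∈ Finset.range c.toNat, ∑ n ∈ Finset.range q₁,
    (starRingEnd ℂ) (χ₂ (j : ZMod q₂)) * (starRingEnd ℂ) (χ₁ (n : ZMod q₁)) *
      ((B1 ((j : ℝ) / (c : ℝ)) * B1 ((n : ℝ) / (q₁ : ℝ) + (a : ℝ) * (j : ℝ) / (c : ℝ)) : ℝ) : ℂ)

theorem aux_sum_mul (f : ℕ → ℂ) (q m : ℕ) :
    ∑ j ∈ Finset.range (m * q), f j =
      ∑ s ∈ Finset.range m, ∑ r ∈ Finset.range q, f (s * q + r) := by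
  induction m with
  | zero => simp
  | succ m ih => rw [Nat.succ_mul, Finset.sum_range_add, ih, Finset.sum_range_succ]

theorem aux_char {q : ℕ} (hq : 1 < q) (χ : DirichletCharacter ℂ q) (h : χ.IsPrimitive) :
    ∑ n ∈ Finset.range q, (starRingEnd ℂ) (χ (n : ZMod q)) = 0 := by
  have : NeZero q := ⟨by omega⟩
  have hne : χ ≠ 1 := by
    rintro rfl
    have h' : DirichletCharacter.conductor (1 : DirichletCharacter ℂ q) = q := h
    rw [DirichletCharacter.conductor_one] at h'
    omega
  have h0 : ∑ a : ZMod q, χ a = 0 := MulChar.sum_eq_zero_of_ne_one hne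
  rw [← map_sum]
  have : ∑ n ∈ Finset.range q, χ (n : ZMod q) = ∑ a : ZMod q, χ a := by
    refine Finset.sum_bij' (fun n _ => (n : ZMod q)) (fun a _ => a.val) ?_ ?_ ?_ ?_ ?_
    · simp
    · intro a _
      simpa using ZMod.val_lt a
    · intro n hn
      exact ZMod.val_cast_of_lt (by simpa using hn)
    · simp
    · simp
  rw [this, h0, map_zero]

theorem aux_shift (q : ℕ) (n : ℕ) :
    ∑ s ∈ Finset.range q, (((n + s) % q : ℕ) : ℂ) = ∑ s ∈ Finset.range q, ((s % q : ℕ) : ℂ) := by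
  induction n with
  | zero => simp
  | succ n ih =>
    rw [← ih]
    have a := Finset.sum_range_succ (fun s => (((n + s) % q : ℕ) : ℂ)) q
    have b := Finset.sum_range_succ' (fun s => (((n + s) % q : ℕ) : ℂ)) q
    simp only [Nat.add_mod_right, add_zero] at a b
    rw [a] at b
    have := add_right_cancel b
    rw [this]
    refine Finset.sum_congr rfl fun s _ => ?_
    rw [show n + 1 + s = n + (s + 1) by ring]

theorem aux_B1 {q₁ q₂ : ℕ} (h1 : 0 < q₁) (m r : ℕ) (hr : 0 < r) (hr2 : r < q₂) (x : ℝ)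
    (hx : x = (m : ℝ) / q₁ + r / (q₁ * q₂)) :
    B1 x = ((m % q₁ : ℕ) : ℝ) / q₁ + r / (q₁ * q₂) - 1 / 2 := by
  have h1' : (0 : ℝ) < q₁ := by exact_mod_cast h1
  have h2' : (0 : ℝ) < q₂ := by exact_mod_cast (by omega : 0 < q₂)
  have hr' : (0 : ℝ) < r := by exact_mod_cast hr
  have hr2' : (r : ℝ) < q₂ := by exact_mod_cast hr2
  have hm : ((m % q₁ : ℕ) : ℝ) + 1 ≤ q₁ := by exact_mod_cast Nat.mod_lt m h1
  have hd : (m : ℝ) = ((m % q₁ : ℕ) : ℝ) + q₁ * ((m / q₁ : ℕ) : ℝ) := by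
    exact_mod_cast (Nat.mod_add_div m q₁).symm
  have hpos : 0 < ((m % q₁ : ℕ) : ℝ) / q₁ + r / (q₁ * q₂) := by positivity
  have hlt : ((m % q₁ : ℕ) : ℝ) / q₁ + r / (q₁ * q₂) < 1 := by
    have e : ((m % q₁ : ℕ) : ℝ) / q₁ + r / (q₁ * q₂)
      = (((m % q₁ : ℕ) : ℝ) + r / q₂) / q₁ := by field_simp
    rw [e, div_lt_one h1']
    have : (r : ℝ) / q₂ < 1 := (div_lt_one h2').2 hr2'
    linarith
  have hf : Int.fract x = ((m % q₁ : ℕ) : ℝ) / q₁ + r / (q₁ * q₂) := by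
    rw [Int.fract_eq_iff]
    refine ⟨hpos.le, hlt, ((m / q₁ : ℕ) : ℤ), ?_⟩
    rw [hx, hd, Int.cast_natCast]
    field_simp
    ring
  rw [B1, hf, if_neg hpos.ne']

/-- `S_{χ₁,χ₂}(1, q₁q₂) = 0`. -/
theorem ded_one_q₁q₂_eq_zero {q₁ q₂ : ℕ} (hq₁ : 1 < q₁) (hq₂ : 1 < q₂)
    (χ₁ : DirichletCharacter ℂ q₁) (χ₂ : DirichletCharacter ℂ q₂)
    (h₁ : χ₁.IsPrimitive) (h₂ : χ₂.IsPrimitive)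
    (hpar : χ₁ (-1) * χ₂ (-1) = 1) :
    ded χ₁ χ₂ 1 ((q₁ * q₂ : ℕ) : ℤ) = 0 := by
  have c1 := aux_char hq₁ χ₁ h₁
  have c2 := aux_char hq₂ χ₂ h₂
  have h1' : (q₁ : ℝ) ≠ 0 := by exact_mod_cast (by omega : q₁ ≠ 0)
  have h2' : (q₂ : ℝ) ≠ 0 := by exact_mod_cast (by omega : q₂ ≠ 0)
  rw [ded, Int.toNat_natCast, aux_sum_mul]
  set G : ℕ → ℂ := fun s => ∑ n ∈ Finset.range q₁,
    (starRingEnd ℂ) (χ₁ (n : ZMod q₁)) * (((n + s) % q₁ : ℕ) : ℂ) with hG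
  have key : ∀ s ∈ Finset.range q₁, ∀ r ∈ Finset.range q₂,
      ∑ n ∈ Finset.range q₁,
        (starRingEnd ℂ) (χ₂ ((s * q₂ + r : ℕ) : ZMod q₂)) * (starRingEnd ℂ) (χ₁ (n : ZMod q₁)) *
      ((B1 (((s * q₂ + r : ℕ) : ℝ) / (((q₁ * q₂ : ℕ) : ℤ) : ℝ)) *
        B1 ((n : ℝ) / (q₁ : ℝ) + ((1 : ℤ) : ℝ) * ((s * q₂ + r : ℕ) : ℝ) /
          (((q₁ * q₂ : ℕ) : ℤ) : ℝ)) : ℝ) : ℂ)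
      = (starRingEnd ℂ) (χ₂ (r : ZMod q₂)) * ((s : ℂ) / q₁ + r / (q₁ * q₂) - 1 / 2)
          * (G s / q₁) := by
    intro s hs r hr
    rw [Finset.mem_range] at hs hr
    have e : (((s * q₂ + r : ℕ) : ZMod q₂)) = r := by simp
    rw [e]
    rcases Nat.eq_zero_or_pos r with rfl | hr0
    · have : Fact (1 < q₂) := ⟨hq₂⟩
      have : χ₂ ((0 : ℕ) : ZMod q₂) = 0 := by
        rw [Nat.cast_zero]
        exact χ₂.map_nonunit not_isUnit_zero
      simp only [this, map_zero, zero_mul, Finset.sum_const_zero]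
    · have b1 := aux_B1 (q₁ := q₁) (q₂ := q₂) (by omega) s r hr0 hr
        (((s * q₂ + r : ℕ) : ℝ) / (((q₁ * q₂ : ℕ) : ℤ) : ℝ)) (by push_cast; field_simp)
      rw [Nat.mod_eq_of_lt hs] at b1
      have b2 := fun n : ℕ => aux_B1 (q₁ := q₁) (q₂ := q₂) (by omega) (n + s) r hr0 hr
        ((n : ℝ) / (q₁ : ℝ) + ((1 : ℤ) : ℝ) * ((s * q₂ + r : ℕ) : ℝ) /
          (((q₁ * q₂ : ℕ) : ℤ) : ℝ)) (by push_cast; field_simp; ring)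
      simp only [b1, b2]
      have : G s / q₁ = ∑ n ∈ Finset.range q₁, (starRingEnd ℂ) (χ₁ (n : ZMod q₁)) *
          ((((n + s) % q₁ : ℕ) : ℂ) / q₁ + r / (q₁ * q₂) - 1 / 2) := by
        simp only [add_sub_assoc, mul_add]
        rw [Finset.sum_add_distrib, ← Finset.sum_mul, c1, hG, Finset.sum_div]
        simp [mul_div_assoc]
      rw [this, Finset.mul_sum]
      refine Finset.sum_congr rfl fun n _ => ?_
      push_cast
      ring
  rw [Finset.sum_congr rfl fun s hs => Finset.sum_congr rfl (key s hs)]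
  have step : ∀ s ∈ Finset.range q₁, ∑ r ∈ Finset.range q₂,
      (starRingEnd ℂ) (χ₂ (r : ZMod q₂)) * ((s : ℂ) / q₁ + r / (q₁ * q₂) - 1 / 2) * (G s / q₁)
      = (∑ r ∈ Finset.range q₂, (starRingEnd ℂ) (χ₂ (r : ZMod q₂)) * ((r : ℂ) / (q₁ * q₂)) / q₁)
        * G s := by
    intro s _
    have : ∀ r : ℕ, (starRingEnd ℂ) (χ₂ (r : ZMod q₂)) *
        ((s : ℂ) / q₁ + r / (q₁ * q₂) - 1 / 2) * (G s / q₁)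
        = (starRingEnd ℂ) (χ₂ (r : ZMod q₂)) * (((s : ℂ) / q₁ - 1 / 2) * (G s / q₁)) +
          (starRingEnd ℂ) (χ₂ (r : ZMod q₂)) * ((r : ℂ) / (q₁ * q₂)) / q₁ * G s := by
      intro r
      ring
    simp only [this]
    rw [Finset.sum_add_distrib, ← Finset.sum_mul, c2, zero_mul, zero_add, Finset.sum_mul]
  rw [Finset.sum_congr rfl step, ← Finset.mul_sum]
  have : ∑ s ∈ Finset.range q₁, G s = 0 := by
    rw [hG, Finset.sum_comm]
    simp only [← Finset.mul_sum, aux_shift]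
    rw [← Finset.sum_mul, c1, zero_mul]
  rw [this, mul_zero]
end

section
/- Let a, c be integers with c > 0, q₁q₂ | c, and gcd(a, c) = 1. If a² + 1 ≡ 0 (mod c) and ψ(a) = 1, where ψ = χ₁χ̄₂, then S_{χ₁,χ₂}(a, c) = 0. -/
open scoped MatrixGroups
open CongruenceSubgroup Matrix

/-- The character `ψ = χ₁ · χ̄₂` modulo `q₁ q₂`. -/
noncomputable def psiChar {q₁ q₂ : ℕ} (χ₁ : DirichletCharacter ℂ q₁)
    (χ₂ : DirichletCharacter ℂ q₂) : DirichletCharacter ℂ (q₁ * q₂) :=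
  DirichletCharacter.changeLevel ⟨q₂, rfl⟩ χ₁ *
    DirichletCharacter.changeLevel ⟨q₁, mul_comm q₁ q₂⟩ (χ₂.ringHomComp (starRingEnd ℂ))

lemma aux_B1_add_int (x : ℝ) (m : ℤ) : B1 (x + m) = B1 x := by
  simp [B1]

lemma aux_B1_neg (x : ℝ) : B1 (-x) = - B1 x := by
  unfold B1
  by_cases h : Int.fract x = 0
  · rw [if_pos h, if_pos (Int.fract_neg_eq_zero.2 h)]; simp
  · rw [if_neg h, if_neg (fun hh => h (Int.fract_neg_eq_zero.1 hh)), Int.fract_neg h]; ring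

/-- `B₁(x / N)` as a function on `ZMod N`. -/
noncomputable def auxBeta (N : ℕ) (x : ZMod N) : ℝ := B1 ((x.val : ℝ) / N)

lemma auxBeta_int (N : ℕ) [NeZero N] (m : ℤ) : auxBeta N (m : ZMod N) = B1 ((m : ℝ) / N) := by
  unfold auxBeta
  have h : (((m : ZMod N).val : ℕ) : ℤ) = m % N := ZMod.val_intCast m
  have h2 : (((m : ZMod N).val : ℕ) : ℝ) = ((m % N : ℤ) : ℝ) := by rw [← h]; simp
  have hN : (N : ℝ) ≠ 0 := by exact_mod_cast NeZero.ne N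
  have h3 : (m : ℝ) / N = ((m % N : ℤ) : ℝ) / N + ((m / N : ℤ) : ℝ) := by
    have : (m : ℝ) = ((m % N : ℤ) : ℝ) + N * ((m / N : ℤ) : ℝ) := by
      exact_mod_cast (Int.emod_add_mul_ediv m N).symm
    field_simp
    linarith
  rw [h2, h3, aux_B1_add_int]

lemma auxBeta_neg (N : ℕ) [NeZero N] (x : ZMod N) : auxBeta N (-x) = - auxBeta N x := by
  obtain ⟨m, rfl⟩ := ZMod.intCast_surjective x
  rw [← Int.cast_neg, auxBeta_int, auxBeta_int, ← aux_B1_neg]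
  push_cast
  rw [neg_div]

lemma aux_sum_range (N : ℕ) [NeZero N] (g : ℕ → ℂ) :
    ∑ j ∈ Finset.range N, g j = ∑ x : ZMod N, g x.val := by
  symm
  refine Finset.sum_bij' (fun x _ => x.val) (fun j _ => (j : ZMod N)) ?_ ?_ ?_ ?_ ?_
  · intro x _; exact Finset.mem_range.2 (ZMod.val_lt x)
  · intro j _; exact Finset.mem_univ _
  · intro x _; simp
  · intro j hj; exact ZMod.val_cast_of_lt (Finset.mem_range.1 hj)
  · intro x _; rfl

/-- If `a² + 1 ≡ 0 (mod c)` and `ψ(a) = 1` then `S_{χ₁,χ₂}(a, c) = 0`. -/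
theorem ded_eq_zero_of_sq_add_one {q₁ q₂ : ℕ} (hq₁ : 1 < q₁) (hq₂ : 1 < q₂)
    (χ₁ : DirichletCharacter ℂ q₁) (χ₂ : DirichletCharacter ℂ q₂)
    (h₁ : χ₁.IsPrimitive) (h₂ : χ₂.IsPrimitive)
    (hpar : χ₁ (-1) * χ₂ (-1) = 1)
    (a c : ℤ) (hc : 0 < c) (hdvd : ((q₁ * q₂ : ℕ) : ℤ) ∣ c) (hcop : IsCoprime a c)
    (hsq : a ^ 2 + 1 ≡ 0 [ZMOD c])
    (hpsi : psiChar χ₁ χ₂ ((a : ZMod (q₁ * q₂))) = 1) :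
    ded χ₁ χ₂ a c = 0 := by
  clear h₁ h₂ hcop
  lift c to ℕ using hc.le
  have hd : q₁ * q₂ ∣ c := by exact_mod_cast hdvd
  obtain ⟨K, rfl⟩ := hd
  set c : ℕ := q₁ * q₂ * K with hcdef
  have hc0 : 0 < c := by exact_mod_cast hc
  have : NeZero c := ⟨hc0.ne'⟩
  have : NeZero q₁ := ⟨by omega⟩
  have : NeZero q₂ := ⟨by omega⟩
  have d1 : q₁ ∣ c := ⟨q₂ * K, by rw [hcdef]; ring⟩
  have d2 : q₂ ∣ c := ⟨q₁ * K, by rw [hcdef]; ring⟩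
  have hsqZ : (c : ℤ) ∣ a ^ 2 + 1 := Int.modEq_zero_iff_dvd.1 hsq
  have sqc : (a : ZMod c) ^ 2 = -1 := by
    have := (ZMod.intCast_zmod_eq_zero_iff_dvd (a ^ 2 + 1) c).2 hsqZ
    push_cast at this
    exact eq_neg_of_add_eq_zero_left this
  have sq1 : (a : ZMod q₁) ^ 2 = -1 := by
    have := (ZMod.intCast_zmod_eq_zero_iff_dvd (a ^ 2 + 1) q₁).2
      ((Int.natCast_dvd_natCast.2 d1).trans hsqZ)
    push_cast at this
    exact eq_neg_of_add_eq_zero_left this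
  have sq2 : (a : ZMod q₂) ^ 2 = -1 := by
    have := (ZMod.intCast_zmod_eq_zero_iff_dvd (a ^ 2 + 1) q₂).2
      ((Int.natCast_dvd_natCast.2 d2).trans hsqZ)
    push_cast at this
    exact eq_neg_of_add_eq_zero_left this
  -- the additive map `n ↦ (c / q₁) n`
  let M : ℕ := q₂ * K
  have hM : c = q₁ * M := by rw [hcdef]; ring
  let L : ZMod q₁ →+ ZMod c := ZMod.lift q₁ ⟨zmultiplesHom (ZMod c) (M : ZMod c), by
    simp only [zmultiplesHom_apply]
    have : ((q₁ * M : ℕ) : ZMod c) = 0 := by rw [← hM]; simp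
    push_cast at this
    simpa using this⟩
  have hL : ∀ m : ℤ, L (m : ZMod q₁) = (m : ZMod c) * (M : ZMod c) := by
    intro m
    simp [L, ZMod.lift_coe]
  have hLa : ∀ n, L ((a : ZMod q₁) * n) = (a : ZMod c) * L n := by
    intro n
    obtain ⟨m, rfl⟩ := ZMod.intCast_surjective n
    rw [← Int.cast_mul, hL, hL]; push_cast; ring
  let π : ZMod c →+* ZMod q₂ := ZMod.castHom d2 (ZMod q₂)
  have hπL : ∀ n, π (L n) = 0 := by
    intro n
    obtain ⟨m, rfl⟩ := ZMod.intCast_surjective n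
    rw [hL]
    simp [M]
  let F : ZMod c × ZMod q₁ → ℂ := fun p =>
    (starRingEnd ℂ) (χ₂ (π p.1)) * (starRingEnd ℂ) (χ₁ p.2) *
      ((auxBeta c p.1 * auxBeta c (a * p.1 + L p.2) : ℝ) : ℂ)
  have hS : ded χ₁ χ₂ a (c : ℤ) = ∑ p, F p := by
    rw [Fintype.sum_prod_type]
    unfold ded
    rw [Int.toNat_natCast, aux_sum_range]
    refine Finset.sum_congr rfl fun j _ => ?_
    rw [aux_sum_range]
    refine Finset.sum_congr rfl fun n _ => ?_
    have e1 : ((j.val : ℕ) : ZMod q₂) = π j := by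
      conv_rhs => rw [← ZMod.natCast_zmod_val j]
      simp [-ZMod.natCast_val]
    have e2 : B1 (((n.val : ℕ) : ℝ) / (q₁ : ℝ) + (a : ℝ) * ((j.val : ℕ) : ℝ) / ((c : ℤ) : ℝ))
        = auxBeta c (a * j + L n) := by
      have : (a : ZMod c) * j + L n = ((a * (j.val : ℤ) + (n.val : ℤ) * (M : ℤ) : ℤ) : ZMod c) := by
        have h1 := hL (n.val : ℤ)
        have h2 : (((n.val : ℕ) : ℤ) : ZMod q₁) = n := by simp
        have h3 : (((j.val : ℕ) : ℤ) : ZMod c) = j := by simp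
        rw [h2] at h1
        rw [h1, Int.cast_add, Int.cast_mul, Int.cast_mul, h3]
        simp
      rw [this, auxBeta_int]
      congr 1
      have hcR : (c : ℝ) = q₁ * M := by exact_mod_cast hM
      have hq0 : (q₁ : ℝ) ≠ 0 := by exact_mod_cast NeZero.ne q₁
      have hcR0 : (q₁ : ℝ) * M ≠ 0 := by rw [← hcR]; exact_mod_cast NeZero.ne c
      have hM0 : (M : ℝ) ≠ 0 := right_ne_zero_of_mul hcR0
      push_cast
      rw [hcR]
      field_simp
      ring
    have e3 : B1 (((j.val : ℕ) : ℝ) / ((c : ℤ) : ℝ)) = auxBeta c j := by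
      simp [auxBeta]
    rw [e1, e2, e3, ZMod.natCast_zmod_val]
  let T : ZMod c × ZMod q₁ → ZMod c × ZMod q₁ := fun p => (a * p.1 + L p.2, -(a * p.2))
  have hT : ∀ p, T (T p) = -p := by
    rintro ⟨j, n⟩
    ext
    · simp only [T, map_neg, hLa, Prod.fst_neg]
      linear_combination j * sqc
    · simp only [T, Prod.snd_neg]
      linear_combination n * sq1
  have hTb : Function.Bijective T := by
    refine Finite.injective_iff_bijective.1 fun p pp h => ?_
    have := congrArg T h
    rw [hT, hT] at this
    exact neg_injective this
  have hpsiA : χ₁ (a : ZMod q₁) * (starRingEnd ℂ) (χ₂ (a : ZMod q₂)) = 1 := by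
    have hu : IsUnit (a : ZMod (q₁ * q₂)) := by
      by_contra h
      rw [MulChar.map_nonunit _ h] at hpsi
      exact zero_ne_one hpsi
    obtain ⟨u, hu⟩ := hu
    rw [← hu, psiChar, MulChar.mul_apply, DirichletCharacter.changeLevel_eq_cast_of_dvd,
      DirichletCharacter.changeLevel_eq_cast_of_dvd, hu,
      ZMod.cast_intCast (Dvd.intro _ rfl), ZMod.cast_intCast (Dvd.intro_left _ rfl)] at hpsi
    exact hpsi
  have x1 : χ₁ (a : ZMod q₁) ^ 2 = χ₁ (-1) := by rw [← map_pow, sq1]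
  have x2 : χ₂ (a : ZMod q₂) ^ 2 = χ₂ (-1) := by rw [← map_pow, sq2]
  have y1 : χ₁ (-1) ^ 2 = 1 := by rw [← map_pow]; simp
  -- the key scalar
  have key : (starRingEnd ℂ) (χ₂ (a : ZMod q₂)) * (starRingEnd ℂ) (χ₁ (-(a : ZMod q₁))) = 1 := by
    rw [← map_mul]
    have : χ₂ (a : ZMod q₂) * χ₁ (-(a : ZMod q₁)) = 1 := by
      have y2 : χ₂ (-1) ^ 2 = 1 := by rw [← map_pow]; simp
      have n4 : ‖χ₂ (a : ZMod q₂)‖ ^ 4 = 1 := by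
        rw [← norm_pow, show (4 : ℕ) = 2 * 2 from rfl, pow_mul, x2, y2, norm_one]
      have n1 : ‖χ₂ (a : ZMod q₂)‖ = 1 :=
        (pow_eq_one_iff_of_nonneg (norm_nonneg _) (by norm_num)).1 n4
      have cy : (starRingEnd ℂ) (χ₂ (a : ZMod q₂)) * χ₂ (a : ZMod q₂) = 1 := by
        rw [Complex.conj_mul', n1]; simp
      have hxy : χ₁ (a : ZMod q₁) = χ₂ (a : ZMod q₂) := by
        linear_combination χ₂ (a : ZMod q₂) * hpsiA - χ₁ (a : ZMod q₁) * cy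
      rw [neg_eq_neg_one_mul, map_mul, ← x1, ← hxy]
      rw [← x1] at y1
      linear_combination y1
    rw [this, map_one]
  have hFT : ∀ p, F (T p) = - F p := by
    rintro ⟨j, n⟩
    have e : (a : ZMod c) * (a * j + L n) + L (-(a * n)) = -j := by
      simp only [map_neg, hLa]
      linear_combination j * sqc
    have eB : π (a * j + L n) = a * π j := by
      rw [map_add, hπL, map_mul]; simp
    have eC : -((a : ZMod q₁) * n) = (-a) * n := by ring
    simp only [F, T]
    rw [e, eB, eC, auxBeta_neg]
    simp only [map_mul]
    push_cast
    linear_combination (- (starRingEnd ℂ) (χ₂ (π j)) * (starRingEnd ℂ) (χ₁ n) *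
      ((auxBeta c j : ℂ) * (auxBeta c (a * j + L n) : ℂ))) * key
  have h := hTb.sum_comp F
  simp only [hFT, Finset.sum_neg_distrib] at h
  rw [hS]
  exact self_eq_neg.1 h.symm
end

section
/- Let n be an integer and d a positive integer. If S_{χ₁,χ₂}(1 + n·d·q₁q₂, d²·q₁q₂) = 0, then S_{χ₁,χ₂}(1 + k·n·d·q₁q₂, k·d²·q₁q₂) = 0 for every integer k ≥ 1. -/
open scoped MatrixGroups
open CongruenceSubgroup Matrix

lemma B1_add_int' (x : ℝ) (z : ℤ) : B1 (x + z) = B1 x := by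
  unfold B1
  rw [Int.fract_add_intCast]

lemma B1_small {N : ℕ} (hN : 0 < N) {u : ℝ} (hu0 : 0 < u) (hu1 : u < 1) {i : ℕ} (hi : i < N) :
    B1 ((u + i) / N) = (u + i) / N - 1 / 2 := by
  have hN' : (0 : ℝ) < N := by exact_mod_cast hN
  have hi' : (i : ℝ) + 1 ≤ N := by exact_mod_cast hi
  have h0 : 0 < (u + i) / N := by positivity
  have h1 : (u + i) / N < 1 := by
    rw [div_lt_one hN']; linarith
  have hf : Int.fract ((u + i) / N) = (u + i) / N := Int.fract_eq_self.2 ⟨h0.le, h1⟩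
  unfold B1
  rw [hf, if_neg h0.ne']

lemma B1_big {N : ℕ} (hN : 0 < N) {u : ℝ} (hu0 : 0 < u) (hu1 : u < 1) {i : ℕ} (hi : N ≤ i)
    (hi2 : i < 2 * N) :
    B1 ((u + i) / N) = (u + i) / N - 3 / 2 := by
  obtain ⟨j, rfl⟩ := Nat.exists_eq_add_of_le hi
  have hN' : (N : ℝ) ≠ 0 := by positivity
  have e : (u + ((N + j : ℕ) : ℝ)) / N = (u + j) / N + ((1 : ℤ) : ℝ) := by
    push_cast; field_simp; ring
  rw [e, B1_add_int', B1_small hN hu0 hu1 (by omega)]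
  push_cast; ring

lemma sum_lin (N : ℕ) (u a b : ℝ) :
    ∑ t ∈ Finset.range N, ((u + t) * a - b) = N * (u * a - b) + a * (N * (N - 1) / 2) := by
  induction N with
  | zero => simp
  | succ n ih => rw [Finset.sum_range_succ, ih]; push_cast; ring

lemma step_sum {N : ℕ} (hN : 0 < N) {u : ℝ} (hu0 : 0 < u) (hu1 : u < 1) (s : ℕ) (hs : s < N) :
    ∑ t ∈ Finset.range N, B1 ((u + t) / N) * B1 ((u + ((t + (s + 1) : ℕ) : ℝ)) / N) =
      ∑ t ∈ Finset.range N, B1 ((u + t) / N) * B1 ((u + ((t + s : ℕ) : ℝ)) / N)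
        + ((s + 1 / 2) / N - 1 / 2) := by
  have hN' : (N : ℝ) ≠ 0 := by positivity
  have key : ∀ t ∈ Finset.range N,
      B1 ((u + t) / N) * B1 ((u + ((t + (s + 1) : ℕ) : ℝ)) / N) =
      B1 ((u + t) / N) * B1 ((u + ((t + s : ℕ) : ℝ)) / N) +
       (((u + t) * (1 / N ^ 2) - 1 / (2 * N)) -
        if t = N - 1 - s then ((u + t) / N - 1 / 2) else 0) := by
    intro t ht
    have ht' := Finset.mem_range.1 ht
    rw [B1_small hN hu0 hu1 ht']
    split_ifs with hc
    · rw [B1_small hN hu0 hu1 (i := t + s) (by omega),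
        B1_big hN hu0 hu1 (i := t + (s + 1)) (by omega) (by omega)]
      push_cast; field_simp; ring
    · by_cases hl : t + (s + 1) < N
      · rw [B1_small hN hu0 hu1 (i := t + s) (by omega),
          B1_small hN hu0 hu1 (i := t + (s + 1)) (by omega)]
        push_cast; field_simp; ring
      · rw [B1_big hN hu0 hu1 (i := t + s) (by omega) (by omega),
          B1_big hN hu0 hu1 (i := t + (s + 1)) (by omega) (by omega)]
        push_cast; field_simp; ring
  rw [Finset.sum_congr rfl key, Finset.sum_add_distrib, Finset.sum_sub_distrib, sum_lin,
    Finset.sum_ite_eq', if_pos (Finset.mem_range.2 (by omega))]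
  have e : ((N - 1 - s : ℕ) : ℝ) = N - 1 - s := by
    rw [Nat.cast_sub (by omega), Nat.cast_sub (by omega)]; simp
  rw [e]
  congr 1
  field_simp
  ring

lemma all_sum {N : ℕ} (hN : 0 < N) {u : ℝ} (hu0 : 0 < u) (hu1 : u < 1) (s : ℕ) (hs : s ≤ N) :
    ∑ t ∈ Finset.range N, B1 ((u + t) / N) * B1 ((u + ((t + s : ℕ) : ℝ)) / N) =
      ∑ t ∈ Finset.range N, B1 ((u + t) / N) * B1 ((u + t) / N)
        + N / 2 * (((s : ℝ) / N) ^ 2 - (s : ℝ) / N) := by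
  have hN' : (N : ℝ) ≠ 0 := by positivity
  induction s with
  | zero => simp
  | succ s ih =>
    rw [step_sum hN hu0 hu1 s (by omega), ih (by omega)]
    push_cast; field_simp; ring

lemma gen_sum {N : ℕ} (hN : 0 < N) {u : ℝ} (hu0 : 0 < u) (hu1 : u < 1) (y : ℝ) (z : ℤ)
    (hz : y = z / N) :
    ∑ t ∈ Finset.range N, B1 ((u + t) / N) * B1 (y + (u + t) / N) =
      ∑ t ∈ Finset.range N, B1 ((u + t) / N) * B1 ((u + t) / N)
        + N / 2 * ((Int.fract y) ^ 2 - Int.fract y) := by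
  have hN' : (N : ℝ) ≠ 0 := by positivity
  have hNz : (0 : ℤ) < N := by exact_mod_cast hN
  obtain ⟨s, hs⟩ := Int.eq_ofNat_of_zero_le (Int.emod_nonneg z hNz.ne')
  have hlt := Int.emod_lt_of_pos z hNz
  have hsN : s < N := by omega
  have hzs : z = s + N * (z / N) := by
    rw [← hs]; exact (Int.emod_add_mul_ediv z N).symm
  set w := z / (N : ℤ)
  have hy : y = (s : ℝ) / N + w := by
    rw [hz, hzs]; push_cast; field_simp
  have hfr : Int.fract y = (s : ℝ) / N := by
    rw [hy, Int.fract_add_intCast]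
    refine Int.fract_eq_self.2 ⟨by positivity, ?_⟩
    rw [div_lt_one (by positivity)]; exact_mod_cast hsN
  rw [hfr, ← all_sum hN hu0 hu1 s hsN.le]
  refine Finset.sum_congr rfl fun t _ => ?_
  have e : y + (u + t) / N = (u + ((t + s : ℕ) : ℝ)) / N + w := by
    rw [hy]; push_cast; ring
  rw [e, B1_add_int']

lemma sum_range_mul' {M : Type*} [AddCommMonoid M] (f : ℕ → M) (a b : ℕ) :
    ∑ j ∈ Finset.range (a * b), f j =
      ∑ r ∈ Finset.range b, ∑ t ∈ Finset.range a, f (r + b * t) := by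
  rw [Finset.sum_comm]
  induction a with
  | zero => simp
  | succ a ih =>
    rw [Nat.succ_mul, Finset.sum_range_add, ih, Finset.sum_range_succ]
    congr 1
    refine Finset.sum_congr rfl fun r _ => ?_
    congr 1; ring

lemma sum_char {q : ℕ} (hq : 1 < q) (χ : DirichletCharacter ℂ q) (h : χ.IsPrimitive) :
    ∑ m ∈ Finset.range q, (starRingEnd ℂ) (χ (m : ZMod q)) = 0 := by
  haveI : NeZero q := ⟨by omega⟩
  have hne : χ ≠ 1 := by
    rintro rfl
    have h' : (1 : DirichletCharacter ℂ q).conductor = q := h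
    rw [DirichletCharacter.conductor_one] at h'
    omega
  rw [← map_sum]
  have : ∑ m ∈ Finset.range q, χ (m : ZMod q) = ∑ x : ZMod q, χ x := by
    refine Finset.sum_bij' (fun m _ => (m : ZMod q)) (fun x _ => x.val) ?_ ?_ ?_ ?_ ?_
    · simp
    · intro x _; simpa using ZMod.val_lt x
    · intro m hm; exact ZMod.val_cast_of_lt (Finset.mem_range.1 hm)
    · intro x _; simp
    · simp
  rw [this, MulChar.sum_eq_zero_of_ne_one hne, map_zero]

lemma ded_formula {q₁ q₂ : ℕ} (hq₁ : 1 < q₁) (hq₂ : 1 < q₂)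
    (χ₁ : DirichletCharacter ℂ q₁) (χ₂ : DirichletCharacter ℂ q₂)
    (h₁ : χ₁.IsPrimitive) (n : ℤ) (d k : ℕ) (hd : 0 < d) (hk : 0 < k) :
    ded χ₁ χ₂ (1 + k * n * d * ((q₁ * q₂ : ℕ) : ℤ)) (k * d ^ 2 * ((q₁ * q₂ : ℕ) : ℤ)) =
      k * ∑ r ∈ Finset.range (d * q₂), ∑ m ∈ Finset.range q₁,
        (starRingEnd ℂ) (χ₂ (r : ZMod q₂)) * (starRingEnd ℂ) (χ₁ (m : ZMod q₁)) *
        ((d * q₁ / 2 * ((Int.fract ((m : ℝ) / q₁ + n * r / d)) ^ 2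
          - Int.fract ((m : ℝ) / q₁ + n * r / d)) : ℝ) : ℂ) := by
  have hc : ((k : ℤ) * (d : ℤ) ^ 2 * ((q₁ * q₂ : ℕ) : ℤ)).toNat = (k * d * q₁) * (d * q₂) := by
    rw [show (k : ℤ) * (d : ℤ) ^ 2 * ((q₁ * q₂ : ℕ) : ℤ) = ((k * d * q₁ * (d * q₂) : ℕ) : ℤ) by
      push_cast; ring]
    exact Int.toNat_natCast _
  unfold ded
  rw [hc, sum_range_mul', Finset.mul_sum]
  refine Finset.sum_congr rfl fun r hr => ?_
  have hr' := Finset.mem_range.1 hr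
  have hchar : ∀ t : ℕ, (((r + d * q₂ * t : ℕ)) : ZMod q₂) = (r : ZMod q₂) := by
    intro t; push_cast; simp
  simp only [hchar]
  rcases Nat.eq_zero_or_pos r with rfl | hr0
  · have : Nontrivial (ZMod q₂) := by
      haveI : Fact (1 < q₂) := ⟨hq₂⟩
      infer_instance
    simp [MulChar.map_nonunit χ₂ (a := 0) (by simp)]
  set N := k * d * q₁ with hNdef
  have hN : 0 < N := by positivity
  have hNr : (N : ℝ) = k * d * q₁ := by rw [hNdef]; push_cast; ring
  have hk' : (k : ℝ) ≠ 0 := by positivity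
  have hd' : (d : ℝ) ≠ 0 := by positivity
  have h1' : (q₁ : ℝ) ≠ 0 := by positivity
  have h2' : (q₂ : ℝ) ≠ 0 := by positivity
  set u : ℝ := (r : ℝ) / (d * q₂) with hu
  have hu0 : 0 < u := by positivity
  have hu1 : u < 1 := by
    rw [hu, div_lt_one (by positivity)]; exact_mod_cast hr'
  rw [Finset.sum_comm]
  have hA : ∀ m ∈ Finset.range q₁, ∑ t ∈ Finset.range N,
      (starRingEnd ℂ) (χ₂ (r : ZMod q₂)) * (starRingEnd ℂ) (χ₁ (m : ZMod q₁)) *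
      ((B1 (((r + d * q₂ * t : ℕ) : ℝ) / (((k : ℤ) * (d : ℤ) ^ 2 * ((q₁ * q₂ : ℕ) : ℤ) : ℤ) : ℝ)) *
        B1 ((m : ℝ) / (q₁ : ℝ) + ((1 + k * n * d * ((q₁ * q₂ : ℕ) : ℤ) : ℤ) : ℝ) *
          ((r + d * q₂ * t : ℕ) : ℝ) /
          (((k : ℤ) * (d : ℤ) ^ 2 * ((q₁ * q₂ : ℕ) : ℤ) : ℤ) : ℝ)) : ℝ) : ℂ) =
      (starRingEnd ℂ) (χ₁ (m : ZMod q₁)) * ((starRingEnd ℂ) (χ₂ (r : ZMod q₂)) *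
        ((∑ t ∈ Finset.range N, B1 ((u + t) / N) * B1 ((u + t) / N) : ℝ) : ℂ)) +
      k * ((starRingEnd ℂ) (χ₂ (r : ZMod q₂)) * (starRingEnd ℂ) (χ₁ (m : ZMod q₁)) *
        ((d * q₁ / 2 * ((Int.fract ((m : ℝ) / q₁ + n * r / d)) ^ 2
          - Int.fract ((m : ℝ) / q₁ + n * r / d)) : ℝ) : ℂ)) := by
    intro m _
    rw [← Finset.mul_sum, ← Complex.ofReal_sum]
    have hg := gen_sum hN hu0 hu1 ((m : ℝ) / q₁ + n * r / d) (k * d * m + k * q₁ * n * r)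
      (by rw [hNr]; push_cast; field_simp)
    have hs : ∑ t ∈ Finset.range N,
      B1 (((r + d * q₂ * t : ℕ) : ℝ) / (((k : ℤ) * (d : ℤ) ^ 2 * ((q₁ * q₂ : ℕ) : ℤ) : ℤ) : ℝ)) *
        B1 ((m : ℝ) / (q₁ : ℝ) + ((1 + k * n * d * ((q₁ * q₂ : ℕ) : ℤ) : ℤ) : ℝ) *
          ((r + d * q₂ * t : ℕ) : ℝ) /
          (((k : ℤ) * (d : ℤ) ^ 2 * ((q₁ * q₂ : ℕ) : ℤ) : ℤ) : ℝ)) =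
        ∑ t ∈ Finset.range N, B1 ((u + t) / N) *
          B1 (((m : ℝ) / q₁ + n * r / d) + (u + t) / N) := by
      refine Finset.sum_congr rfl fun t _ => ?_
      have e1 : ((r + d * q₂ * t : ℕ) : ℝ) /
          (((k : ℤ) * (d : ℤ) ^ 2 * ((q₁ * q₂ : ℕ) : ℤ) : ℤ) : ℝ) = (u + t) / N := by
        rw [hNr, hu]; push_cast; field_simp
      have e2 : (m : ℝ) / (q₁ : ℝ) + ((1 + k * n * d * ((q₁ * q₂ : ℕ) : ℤ) : ℤ) : ℝ) *
          ((r + d * q₂ * t : ℕ) : ℝ) /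
          (((k : ℤ) * (d : ℤ) ^ 2 * ((q₁ * q₂ : ℕ) : ℤ) : ℤ) : ℝ) =
          (((m : ℝ) / q₁ + n * r / d) + (u + t) / N) + ((n * q₂ * t : ℤ) : ℝ) := by
        rw [hNr, hu]; push_cast; field_simp; ring
      rw [e1, e2, B1_add_int']
    rw [hs, hg, hNr]
    push_cast
    ring
  rw [Finset.sum_congr rfl hA, Finset.sum_add_distrib, ← Finset.sum_mul, sum_char hq₁ χ₁ h₁,
    zero_mul, zero_add, Finset.mul_sum]

/-- If `S_{χ₁,χ₂}(1 + ndq₁q₂, d²q₁q₂) = 0` then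
`S_{χ₁,χ₂}(1 + kndq₁q₂, kd²q₁q₂) = 0` for all `k ≥ 1`. -/
theorem ded_multiples {q₁ q₂ : ℕ} (hq₁ : 1 < q₁) (hq₂ : 1 < q₂)
    (χ₁ : DirichletCharacter ℂ q₁) (χ₂ : DirichletCharacter ℂ q₂)
    (h₁ : χ₁.IsPrimitive) (h₂ : χ₂.IsPrimitive)
    (hpar : χ₁ (-1) * χ₂ (-1) = 1)
    (n d : ℤ) (hd : 0 < d)
    (h : ded χ₁ χ₂ (1 + n * d * ((q₁ * q₂ : ℕ) : ℤ)) (d ^ 2 * ((q₁ * q₂ : ℕ) : ℤ)) = 0) :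
    ∀ k : ℤ, 1 ≤ k →
      ded χ₁ χ₂ (1 + k * n * d * ((q₁ * q₂ : ℕ) : ℤ)) (k * d ^ 2 * ((q₁ * q₂ : ℕ) : ℤ)) = 0 := by
  intro k hk
  lift d to ℕ using hd.le
  lift k to ℕ using (by omega)
  have hd' : 0 < d := by exact_mod_cast hd
  have hk' : 0 < k := by omega
  have e := ded_formula hq₁ hq₂ χ₁ χ₂ h₁ n d 1 hd' one_pos
  simp only [Nat.cast_one, one_mul] at e
  rw [h] at e
  rw [ded_formula hq₁ hq₂ χ₁ χ₂ h₁ n d k hd' hk', ← e, mul_zero]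
end
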